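/- arXiv:1711.02764 — 3 statements merged into one kernel-verified Lean document; each statement's English description precedes it below -/
import Mathlib

section
/- Let Ξ ⊆ Ω be any set, λ ∈ ℝ, and H, G ∈ ℋ such that λ + (H·S)_t + (G·𝕊)_t ≥ 0 on Ξ for all t ∈ [0,T]. Then for every ε > 0 there exists Y ∈ 𝒢^Ξ_{λ+ε} such that Y ≥ λ + (H·S)_T + (G·𝕊)_T on Ξ. -/
open MeasureTheory Filter Set Topology
open scoped ENNReal Classical

noncomputable section

namespace PathwiseSuperhedging

/-- The path space `C[0,T]`: continuous functions on `[0,T]` with the sup-norm. -/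
abbrev Path (T : ℝ) := C(Set.Icc (0:ℝ) T, ℝ)

variable (T : ℝ)

instance : MeasurableSpace (Path T) := borel _
instance : BorelSpace (Path T) := ⟨rfl⟩

variable (hT : 0 ≤ T)

/-- time `0` as an element of `[0,T]`. -/
def t0 : Set.Icc (0:ℝ) T := ⟨0, le_refl 0, hT⟩

/-- clamp a real time into `[0,T]`. -/
def clamp (t : ℝ) : Set.Icc (0:ℝ) T := Set.projIcc 0 T hT t

/-- evaluation of a path at a (clamped) real time. -/
def ev (ω : Path T) (t : ℝ) : ℝ := ω (clamp T hT t)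

/-- The stopping times `σ^m_k`:  `σ^m_0 = 0` and
`σ^m_{k+1} = inf { t ≥ σ^m_k : |S_t - S_{σ^m_k}| ≥ 2^{-m} }` (equal to `T+1` if no such
time `t ≤ T` exists). -/
def sig (m : ℕ) : ℕ → Path T → ℝ
  | 0 => fun _ => 0
  | k + 1 => fun ω =>
      sInf ({t : ℝ | sig m k ω ≤ t ∧ t ≤ T ∧
        (2:ℝ) ^ (-(m:ℤ)) ≤ |ev T hT ω t - ev T hT ω (sig m k ω)|} ∪ {T + 1})

/-- The discretized integral `𝕊^m_t = ∑_k S_{σ^m_k} (S_{σ^m_{k+1} ∧ t} - S_{σ^m_k ∧ t})`. -/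
def Sm (m : ℕ) (t : ℝ) (ω : Path T) : ℝ :=
  ∑' k : ℕ, ev T hT ω (sig T hT m k ω) *
    (ev T hT ω (min (sig T hT m (k + 1) ω) t) - ev T hT ω (min (sig T hT m k ω) t))

/-- The pathwise integral `𝕊_t = liminf_m 𝕊^m_t`. -/
def SS (t : ℝ) (ω : Path T) : ℝ := Filter.liminf (fun m => Sm T hT m t ω) Filter.atTop

/-- The candidate quadratic variation `S_t² - S_0² - 2 𝕊_t`. -/
def qvRaw (ω : Path T) (t : ℝ) : ℝ := (ev T hT ω t) ^ 2 - (ev T hT ω 0) ^ 2 - 2 * SS T hT t ω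

/-- The set `Ω` of paths for which `𝕊^m → 𝕊` uniformly and
`t ↦ S_t² - S_0² - 2𝕊_t` is nondecreasing. -/
def BigOmega : Set (Path T) :=
  {ω | TendstoUniformly (fun m (t : Set.Icc (0:ℝ) T) => Sm T hT m (t : ℝ) ω)
        (fun t => SS T hT (t : ℝ) ω) Filter.atTop ∧
      MonotoneOn (qvRaw T hT ω) (Set.Icc (0:ℝ) T)}

/-- The pathwise quadratic variation `⟨ω⟩`, as an element of `C[0,T]`; it equals
`S² - S_0² - 2𝕊` for `ω ∈ Ω` (this function being continuous there) and `0` otherwise. -/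
def qv (ω : Path T) : Path T :=
  if h : ω ∈ BigOmega T hT ∧ Continuous fun t : Set.Icc (0:ℝ) T => qvRaw T hT ω (t : ℝ)
  then ⟨fun t => qvRaw T hT ω (t : ℝ), h.2⟩ else 0

/-- The raw filtration `F_t = σ(S_s : s ≤ t)` generated by the canonical process. -/
def Fraw (t : ℝ) : MeasurableSpace (Path T) :=
  ⨆ (s : Set.Icc (0:ℝ) T) (_ : (s : ℝ) ≤ t),
    MeasurableSpace.comap (fun ω : Path T => ω s) inferInstance

/-- The right-continuous filtration `F_{t+} = ⋂_{s > t} F_{s ∧ T}`. -/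
def Fplus (t : ℝ) : MeasurableSpace (Path T) :=
  ⨅ (s : ℝ) (_ : t < s), Fraw T (min s T)

/-- `τ` is a stopping time for the raw filtration `𝔽`. -/
def IsStopRaw (τ : Path T → ℝ) : Prop :=
  ∀ t ∈ Set.Icc (0:ℝ) T, MeasurableSet[Fraw T t] {ω | τ ω ≤ t}

/-- `τ` is a stopping time for the right-continuous filtration `𝔽₊`. -/
def IsStopPlus (τ : Path T → ℝ) : Prop :=
  ∀ t ∈ Set.Icc (0:ℝ) T, MeasurableSet[Fplus T t] {ω | τ ω ≤ t}

/-- `f` is measurable with respect to the σ-field `F_{τ+}`. -/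
def MeasAtStopPlus (τ f : Path T → ℝ) : Prop :=
  ∀ B : Set ℝ, MeasurableSet B → ∀ t ∈ Set.Icc (0:ℝ) T,
    MeasurableSet[Fplus T t] (f ⁻¹' B ∩ {ω | τ ω ≤ t})

/-- The set `ℋ` of simple trading strategies `H = ∑_{l=1}^L h_l 1_{(τ_l, τ_{l+1}]}`
with `𝔽₊`-stopping times `0 ≤ τ_1 ≤ ⋯ ≤ τ_{L+1} ≤ T` and bounded `F_{τ_l+}`-measurable
coefficients `h_l`. -/
structure SimpleStrategy where
  L : ℕ
  τ : Fin (L + 1) → Path T → ℝ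
  coeff : Fin L → Path T → ℝ
  τ_nonneg : ∀ ω, 0 ≤ τ 0 ω
  τ_mono : ∀ (l : Fin L) (ω), τ l.castSucc ω ≤ τ l.succ ω
  τ_le : ∀ ω, τ (Fin.last L) ω ≤ T
  τ_stop : ∀ l, IsStopPlus T (τ l)
  coeff_bdd : ∀ l, ∃ C : ℝ, ∀ ω, |coeff l ω| ≤ C
  coeff_meas : ∀ l : Fin L, MeasAtStopPlus T (τ l.castSucc) (coeff l)

/-- The pathwise stochastic integral `(H · X)_t(ω)` of a simple strategy against a process. -/
def integ (H : SimpleStrategy T) (X : ℝ → Path T → ℝ) (t : ℝ) (ω : Path T) : ℝ :=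
  ∑ l : Fin H.L, H.coeff l ω *
    (X (min (H.τ l.succ ω) t) ω - X (min (H.τ l.castSucc ω) t) ω)

/-- The canonical process `S_t(ω) = ω(t)`. -/
def Sproc (t : ℝ) (ω : Path T) : ℝ := ev T hT ω t

/-- `X` is a `Q`-`𝔽`-martingale (on the time interval `[0,T]`). -/
def IsMart (Q : Measure (Path T)) (X : ℝ → Path T → ℝ) : Prop :=
  (∀ t ∈ Set.Icc (0:ℝ) T, Integrable (X t) Q) ∧
  ∀ s t : ℝ, s ∈ Set.Icc (0:ℝ) T → t ∈ Set.Icc (0:ℝ) T → s ≤ t →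
    ∀ A : Set (Path T), MeasurableSet[Fraw T s] A →
      ∫ ω in A, X t ω ∂Q = ∫ ω in A, X s ω ∂Q

/-- `X` is a `Q`-`𝔽`-local martingale: there are `𝔽`-stopping times increasing `Q`-a.s.
to `∞` such that each stopped process is a `Q`-`𝔽`-martingale. -/
def IsLocalMart (Q : Measure (Path T)) (X : ℝ → Path T → ℝ) : Prop :=
  ∃ τ : ℕ → Path T → ℝ,
    (∀ m, IsStopRaw T (τ m)) ∧
    (∀ᵐ ω ∂Q, Monotone (fun m => τ m ω) ∧ Tendsto (fun m => τ m ω) atTop atTop) ∧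
    (∀ m, IsMart T Q (fun t ω => X (min (τ m ω) t) ω))

/-- The set `M(Ξ)` of local martingale measures concentrated on `Ξ`. -/
def MSet (Ξ : Set (Path T)) : Set (Measure (Path T)) :=
  {Q | IsProbabilityMeasure Q ∧ IsLocalMart T Q (Sproc T hT) ∧ Q Ξ = 1}

/-- The set `M_Z(Ξ)` of local martingale measures concentrated on `Ξ` with `E_Q[Z] < ∞`. -/
def MZSet (Ξ : Set (Path T)) (Z : Path T → ℝ≥0∞) : Set (Measure (Path T)) :=
  {Q | IsProbabilityMeasure Q ∧ IsLocalMart T Q (Sproc T hT) ∧ Q Ξ = 1 ∧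
       ∫⁻ ω, Z ω ∂Q ≠ ⊤}

/-- The stopped path `ω^t(s) = ω(t ∧ s)`. -/
def stopPath (ω : Path T) (t : Set.Icc (0:ℝ) T) : Path T :=
  ⟨fun s => ω ⟨min t.1 s.1, le_min t.2.1 s.2.1, (min_le_left _ _).trans t.2.2⟩,
    ω.continuous.comp ((continuous_const.min continuous_subtype_val).subtype_mk _)⟩

/-- Assumption A on the prediction set `Ξ` and its lift `Ξ̄`. -/
structure AssumptionA (Ξ : Set (Path T)) (Xibar : Set (Path T × Path T)) : Prop where
  xi_nonempty : Ξ.Nonempty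
  xibar_nonempty : Xibar.Nonempty
  xi_eq : Ξ = {ω ∈ BigOmega T hT | (ω, qv T hT ω) ∈ Xibar}
  A1 : ∃ K : ℕ → Set (Path T × Path T), (∀ n, IsCompact (K n)) ∧ Xibar = ⋃ n, K n
  A2 : ∀ p ∈ Xibar, p.2 (t0 T hT) = 0 ∧ Monotone p.2
  A3 : ∀ p ∈ Xibar, ∀ t : Set.Icc (0:ℝ) T, (stopPath T p.1 t, stopPath T p.2 t) ∈ Xibar

/-! ### The enlarged space -/

/-- The enlarged space `Ω̄ = C[0,T] × C[0,T]`. -/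
abbrev PathPair (T : ℝ) := Path T × Path T

/-- The embedding `ψ(ω) = (ω, ⟨ω⟩)`. -/
def psiMap (ω : Path T) : PathPair T := (ω, qv T hT ω)

/-- The diagonal set `Δ̄ = ψ(Ω)`. -/
def Delta : Set (PathPair T) := psiMap T hT '' BigOmega T hT

/-- The first canonical process `S̄_t(ω,ν) = ω(t)` on the enlarged space. -/
def SbarProc (t : ℝ) (p : PathPair T) : ℝ := ev T hT p.1 t

/-- The second canonical process `V̄_t(ω,ν) = ν(t)` on the enlarged space. -/
def VbarProc (t : ℝ) (p : PathPair T) : ℝ := ev T hT p.2 t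

/-- The process `𝕊̄ = (S̄² - S̄_0² - V̄)/2` on the enlarged space. -/
def SSbarProc (t : ℝ) (p : PathPair T) : ℝ :=
  ((ev T hT p.1 t) ^ 2 - (ev T hT p.1 0) ^ 2 - ev T hT p.2 t) / 2

/-- The raw filtration `F̄_t = σ(S̄_s, V̄_s : s ≤ t)` on the enlarged space. -/
def FbarRaw (t : ℝ) : MeasurableSpace (PathPair T) :=
  ⨆ (s : Set.Icc (0:ℝ) T) (_ : (s : ℝ) ≤ t),
    MeasurableSpace.comap (fun p : PathPair T => (p.1 s, p.2 s)) inferInstance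

/-- The right-continuous filtration `F̄_{t+} = ⋂_{s>t} F̄_{s ∧ T}` on the enlarged space. -/
def FbarPlus (t : ℝ) : MeasurableSpace (PathPair T) :=
  ⨅ (s : ℝ) (_ : t < s), FbarRaw T (min s T)

/-- The σ-field generated by all subsets of `Δ̄ᶜ`. -/
def nullDelta : MeasurableSpace (PathPair T) :=
  MeasurableSpace.generateFrom {N : Set (PathPair T) | N ⊆ (Delta T hT)ᶜ}

/-- The `Δ̄`-augmented raw filtration `F̄^Δ_t`. -/
def FbarDelta (t : ℝ) : MeasurableSpace (PathPair T) := FbarRaw T t ⊔ nullDelta T hT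

/-- The `Δ̄`-augmented right-continuous filtration `F̄^Δ_{t+}`. -/
def FbarDeltaPlus (t : ℝ) : MeasurableSpace (PathPair T) := FbarPlus T t ⊔ nullDelta T hT

/-- `τ` is a stopping time for the raw filtration `𝔽̄` on the enlarged space. -/
def IsStopBarRaw (τ : PathPair T → ℝ) : Prop :=
  ∀ t ∈ Set.Icc (0:ℝ) T, MeasurableSet[FbarRaw T t] {p | τ p ≤ t}

/-- `τ` is a stopping time for the filtration `𝔽̄₊^Δ`. -/
def IsStopBarDeltaPlus (τ : PathPair T → ℝ) : Prop :=
  ∀ t ∈ Set.Icc (0:ℝ) T, MeasurableSet[FbarDeltaPlus T hT t] {p | τ p ≤ t}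

/-- `f` is measurable with respect to `F̄^Δ_{τ+}`. -/
def MeasAtStopBarDeltaPlus (τ f : PathPair T → ℝ) : Prop :=
  ∀ B : Set ℝ, MeasurableSet B → ∀ t ∈ Set.Icc (0:ℝ) T,
    MeasurableSet[FbarDeltaPlus T hT t] (f ⁻¹' B ∩ {p | τ p ≤ t})

/-- The set `ℋ̄` of simple strategies on the enlarged space. -/
structure SimpleStrategyBar where
  L : ℕ
  τ : Fin (L + 1) → PathPair T → ℝ
  coeff : Fin L → PathPair T → ℝ
  τ_nonneg : ∀ p, 0 ≤ τ 0 p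
  τ_mono : ∀ (l : Fin L) (p), τ l.castSucc p ≤ τ l.succ p
  τ_le : ∀ p, τ (Fin.last L) p ≤ T
  τ_stop : ∀ l, IsStopBarDeltaPlus T hT (τ l)
  coeff_bdd : ∀ l, ∃ C : ℝ, ∀ p, |coeff l p| ≤ C
  coeff_meas : ∀ l : Fin L, MeasAtStopBarDeltaPlus T hT (τ l.castSucc) (coeff l)

/-- The pathwise stochastic integral on the enlarged space. -/
def integBar (H : SimpleStrategyBar T hT) (X : ℝ → PathPair T → ℝ) (t : ℝ)
    (p : PathPair T) : ℝ :=
  ∑ l : Fin H.L, H.coeff l p *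
    (X (min (H.τ l.succ p) t) p - X (min (H.τ l.castSucc p) t) p)

/-- `X` is a `Q̄`-`𝔽̄`-martingale on the enlarged space. -/
def IsMartBar (Q : Measure (PathPair T)) (X : ℝ → PathPair T → ℝ) : Prop :=
  (∀ t ∈ Set.Icc (0:ℝ) T, Integrable (X t) Q) ∧
  ∀ s t : ℝ, s ∈ Set.Icc (0:ℝ) T → t ∈ Set.Icc (0:ℝ) T → s ≤ t →
    ∀ A : Set (PathPair T), MeasurableSet[FbarRaw T s] A →
      ∫ p in A, X t p ∂Q = ∫ p in A, X s p ∂Q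

/-- `X` is a `Q̄`-`𝔽̄`-local martingale on the enlarged space. -/
def IsLocalMartBar (Q : Measure (PathPair T)) (X : ℝ → PathPair T → ℝ) : Prop :=
  ∃ τ : ℕ → PathPair T → ℝ,
    (∀ m, IsStopBarRaw T (τ m)) ∧
    (∀ᵐ p ∂Q, Monotone (fun m => τ m p) ∧ Tendsto (fun m => τ m p) atTop atTop) ∧
    (∀ m, IsMartBar T Q (fun t p => X (min (τ m p) t) p))

/-- The set `M̄(Ξ̄)` of measures on the enlarged space under which `S̄` and `𝕊̄` are local
martingales and which are concentrated on `Ξ̄`. -/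
def MbarSet (Xibar : Set (PathPair T)) : Set (Measure (PathPair T)) :=
  {Q | IsProbabilityMeasure Q ∧ IsLocalMartBar T Q (SbarProc T hT) ∧
       IsLocalMartBar T Q (SSbarProc T hT) ∧ Q Xibar = 1}

/-- The set `M̄_{Z̄}(Ξ̄)`. -/
def MbarZSet (Xibar : Set (PathPair T)) (Zbar : PathPair T → ℝ≥0∞) :
    Set (Measure (PathPair T)) :=
  {Q | IsProbabilityMeasure Q ∧ IsLocalMartBar T Q (SbarProc T hT) ∧
       IsLocalMartBar T Q (SSbarProc T hT) ∧ Q Xibar = 1 ∧ ∫⁻ p, Zbar p ∂Q ≠ ⊤}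

/-! ### Expectations and superhedging functionals -/

/-- The positive part of an extended real number, as an element of `[0,∞]`. -/
def erealPos (x : EReal) : ℝ≥0∞ := if x = ⊤ then ⊤ else ENNReal.ofReal x.toReal

/-- The expectation `E_Q[ξ]` of an extended-real-valued random variable, as an
extended real number (positive part minus negative part). -/
def expEReal {α : Type*} [MeasurableSpace α] (Q : Measure α) (ξ : α → EReal) : EReal :=
  ((∫⁻ x, erealPos (ξ x) ∂Q : ℝ≥0∞) : EReal) - ((∫⁻ x, erealPos (-ξ x) ∂Q : ℝ≥0∞) : EReal)

/-- The set of initial capitals `λ` that allow superhedging `ξ` on `Ξ`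
(trading in `S` and `𝕊` with simple strategies, in the liminf sense). -/
def PhiSet (Ξ : Set (Path T)) (ξ : Path T → EReal) : Set ℝ :=
  {lam : ℝ | ∃ H G : ℕ → SimpleStrategy T,
    (∀ n : ℕ, ∀ t ∈ Set.Icc (0:ℝ) T, ∀ ω ∈ Ξ,
      0 ≤ lam + integ T (H n) (Sproc T hT) t ω + integ T (G n) (SS T hT) t ω) ∧
    (∀ ω ∈ Ξ, ξ ω ≤ (lam : EReal) +
      Filter.liminf (fun n =>
        ((integ T (H n) (Sproc T hT) T ω + integ T (G n) (SS T hT) T ω : ℝ) : EReal))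
        Filter.atTop)}

/-- The superhedging price `Φ(ξ)`. -/
def Phi (Ξ : Set (Path T)) (ξ : Path T → EReal) : EReal :=
  sInf ((fun lam : ℝ => (lam : EReal)) '' PhiSet T hT Ξ ξ)

/-- The supremum of the pricing functionals `E_Q[ξ]` over `Q ∈ M(Ξ)`,
for a nonnegative claim `ξ`. -/
def supMart (Ξ : Set (Path T)) (ξ : Path T → ℝ≥0∞) : ℝ≥0∞ :=
  ⨆ Q ∈ MSet T hT Ξ, ∫⁻ ω, ξ ω ∂Q

/-- The liminf-closure `𝒢^Ξ_λ`: the smallest set of functions `C[0,T] → [-∞,∞]`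
containing `λ + (H·S)_T` for admissible simple `H` and closed under countable liminf. -/
inductive GG (Ξ : Set (Path T)) (lam : ℝ) : (Path T → EReal) → Prop
  | base (H : SimpleStrategy T)
      (hadm : ∀ t ∈ Set.Icc (0:ℝ) T, ∀ ω ∈ Ξ, 0 ≤ lam + integ T H (Sproc T hT) t ω) :
      GG Ξ lam (fun ω => ((lam + integ T H (Sproc T hT) T ω : ℝ) : EReal))
  | lim (X : ℕ → Path T → EReal) (h : ∀ n, GG Ξ lam (X n)) :
      GG Ξ lam (fun ω => Filter.liminf (fun n => X n ω) Filter.atTop)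

/-- The superhedging price `Φ^cl(ξ)` defined via the liminf-closure. -/
def PhiCl (Ξ : Set (Path T)) (ξ : Path T → EReal) : EReal :=
  sInf {x : EReal | ∃ lam : ℝ, x = (lam : EReal) ∧
    ∃ Y : Path T → EReal, GG T hT Ξ lam Y ∧ ∀ ω ∈ Ξ, ξ ω ≤ Y ω}


/-- The set of initial capitals allowing superhedging on the enlarged space
(superhedging on `Δ̄ ∩ Ξ̄`). -/
def PhiBarSet (Xibar : Set (PathPair T)) (ξ : PathPair T → EReal) : Set ℝ :=
  {lam : ℝ | ∃ H G : ℕ → SimpleStrategyBar T hT,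
    (∀ n : ℕ, ∀ t ∈ Set.Icc (0:ℝ) T, ∀ p ∈ Delta T hT ∩ Xibar,
      0 ≤ lam + integBar T hT (H n) (SbarProc T hT) t p
            + integBar T hT (G n) (SSbarProc T hT) t p) ∧
    (∀ p ∈ Delta T hT ∩ Xibar, ξ p ≤ (lam : EReal) +
      Filter.liminf (fun n =>
        ((integBar T hT (H n) (SbarProc T hT) T p
          + integBar T hT (G n) (SSbarProc T hT) T p : ℝ) : EReal)) Filter.atTop)}

/-- The superhedging price `Φ̄(ξ̄)` on the enlarged space. -/
def PhiBar (Xibar : Set (PathPair T)) (ξ : PathPair T → EReal) : EReal :=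
  sInf ((fun lam : ℝ => (lam : EReal)) '' PhiBarSet T hT Xibar ξ)

/-- The supremum of pricing functionals over `M̄(Ξ̄)` for a nonnegative claim. -/
def supMartBar (Xibar : Set (PathPair T)) (ξ : PathPair T → ℝ≥0∞) : ℝ≥0∞ :=
  ⨆ Q ∈ MbarSet T hT Xibar, ∫⁻ p, ξ p ∂Q

/-- Assumption B on the prediction set `Ξ`, determined by a growth function `Z̄`
(with values in `[1,∞]`). -/
structure AssumptionB (Ξ : Set (Path T)) (Zbar : PathPair T → ℝ≥0∞) : Prop where
  xi_nonempty : Ξ.Nonempty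
  one_le : ∀ p, 1 ≤ Zbar p
  xi_eq : Ξ = {ω ∈ BigOmega T hT | Zbar (ω, qv T hT ω) ≠ ⊤}
  B1 : ∀ c : ℝ≥0∞, c ≠ ⊤ → IsCompact {p : PathPair T | Zbar p ≤ c}
  B2 : ∀ p : PathPair T, Zbar p ≠ ⊤ → p.2 (t0 T hT) = 0 ∧ Monotone p.2
  B3 : ∀ p : PathPair T, ENNReal.ofReal (‖p.1‖ + ‖p.2‖) ≤ Zbar p

/-- The set of initial capitals allowing `Z`-admissible superhedging of `ξ` on `Ξ`. -/
def PhiZSet (Ξ : Set (Path T)) (Z : Path T → ℝ≥0∞) (ξ : Path T → EReal) : Set ℝ :=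
  {lam : ℝ | ∃ c : ℝ, 0 ≤ c ∧ ∃ H G : ℕ → SimpleStrategy T,
    (∀ n : ℕ, ∀ ω ∈ Ξ,
      -(c * (Z ω).toReal) ≤
        lam + integ T (H n) (Sproc T hT) T ω + integ T (G n) (SS T hT) T ω) ∧
    (∀ ω ∈ Ξ, ξ ω ≤ (lam : EReal) +
      Filter.liminf (fun n =>
        ((integ T (H n) (Sproc T hT) T ω + integ T (G n) (SS T hT) T ω : ℝ) : EReal))
        Filter.atTop)}

/-- The superhedging price `Φ^Z(ξ)`. -/
def PhiZ (Ξ : Set (Path T)) (Z : Path T → ℝ≥0∞) (ξ : Path T → EReal) : EReal :=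
  sInf ((fun lam : ℝ => (lam : EReal)) '' PhiZSet T hT Ξ Z ξ)

/-- The `α`-Hölder norm `‖ω‖_α = |ω(0)| + sup_{s ≠ t} |ω(t) - ω(s)| / |t-s|^α`,
with values in `[0,∞]`. -/
def holderNormE (α : ℝ) (ω : Path T) : ℝ≥0∞ :=
  ENNReal.ofReal |ω (t0 T hT)| +
    ⨆ (s : Set.Icc (0:ℝ) T) (t : Set.Icc (0:ℝ) T) (_ : s ≠ t),
      ENNReal.ofReal (|ω t - ω s| / |t.1 - s.1| ^ α)

/-- The set of Hölder continuous paths `⋃_n { ω : ‖ω‖_{1/n} ≤ n }`. -/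
def CHolder : Set (Path T) :=
  ⋃ n : ℕ, {ω : Path T | 0 < n ∧ holderNormE T hT (1 / n) ω ≤ (n : ℝ≥0∞)}

end PathwiseSuperhedging

namespace PathwiseSuperhedging

section helpers

variable (T : ℝ)

lemma Fplus_mono {s t : ℝ} (h : s ≤ t) : Fplus T s ≤ Fplus T t := by
  unfold Fplus
  refine le_iInf₂ fun u hu => ?_
  exact iInf₂_le u (lt_of_le_of_lt h hu)

lemma hit_meas {Ω : Type*} [MeasurableSpace Ω] (X : ℝ → Ω → ℝ)
    (hc : ∀ ω, Continuous fun s => X s ω) (t : ℝ) (ht : 0 ≤ t)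
    (hm : ∀ s ∈ Icc (0:ℝ) t, Measurable (X s)) :
    MeasurableSet {ω | ∃ s ∈ Icc (0:ℝ) t, X s ω ≤ 0} := by
  have hp : ∀ q : ℚ, t * (projIcc (0:ℝ) 1 zero_le_one (q:ℝ) : ℝ) ∈ Icc (0:ℝ) t := by
    intro q
    have := (projIcc (0:ℝ) 1 zero_le_one (q:ℝ)).2
    exact ⟨mul_nonneg ht this.1, mul_le_of_le_one_right ht this.2⟩
  have key : {ω | ∃ s ∈ Icc (0:ℝ) t, X s ω ≤ 0} =
      ⋂ n : ℕ, ⋃ q : ℚ, {ω | X (t * (projIcc (0:ℝ) 1 zero_le_one (q:ℝ) : ℝ)) ω < 1 / ((n:ℝ) + 1)} := by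
    ext ω
    simp only [mem_ofPred_eq, mem_iInter, mem_iUnion]
    constructor
    · rintro ⟨s, hs, hX⟩ n
      obtain ⟨r, hr, hrs⟩ : ∃ r ∈ Icc (0:ℝ) 1, t * r = s := by
        rcases ht.eq_or_lt with h0 | h0
        · refine ⟨0, by simp, ?_⟩
          have h1 := hs.1
          have h2 := hs.2
          linarith
        · refine ⟨s / t, ⟨div_nonneg hs.1 ht, div_le_one_of_le₀ hs.2 ht⟩, by field_simp⟩
      have hcont : Continuous fun r : ℝ => X (t * (projIcc (0:ℝ) 1 zero_le_one r : ℝ)) ω :=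
        (hc ω).comp (continuous_const.mul (continuous_subtype_val.comp continuous_projIcc))
      have hopen : IsOpen {r : ℝ | X (t * (projIcc (0:ℝ) 1 zero_le_one r : ℝ)) ω < 1 / ((n:ℝ)+1)} :=
        isOpen_lt hcont continuous_const
      have hne : r ∈ {r : ℝ | X (t * (projIcc (0:ℝ) 1 zero_le_one r : ℝ)) ω < 1 / ((n:ℝ)+1)} := by
        simp only [mem_ofPred_eq]
        rw [projIcc_of_mem _ hr]
        simp only [hrs]
        have : (0:ℝ) < 1 / ((n:ℝ)+1) := by positivity
        linarith
      obtain ⟨q, hq⟩ := Rat.denseRange_cast.exists_mem_open hopen ⟨r, hne⟩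
      exact ⟨q, hq⟩
    · intro h
      obtain ⟨s, hs, hmin⟩ := (isCompact_Icc (a := (0:ℝ)) (b := t)).exists_isMinOn
        ⟨0, by simp [ht]⟩ ((hc ω).continuousOn)
      refine ⟨s, hs, ?_⟩
      by_contra hpos
      push Not at hpos
      obtain ⟨n, hn⟩ := exists_nat_one_div_lt hpos
      obtain ⟨q, hq⟩ := h n
      have := hmin (hp q)
      simp only [mem_ofPred_eq] at this
      linarith
  rw [key]
  refine MeasurableSet.iInter fun n => MeasurableSet.iUnion fun q => ?_
  exact measurableSet_lt (hm _ (hp q)) measurable_const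

/-- stopping time with values in `[0,T]` -/
structure Nice (τ : Path T → ℝ) : Prop where
  nn : ∀ ω, 0 ≤ τ ω
  le : ∀ ω, τ ω ≤ T
  st : IsStopPlus T τ

variable {T}

lemma Nice.min {τ σ : Path T → ℝ} (h : Nice T τ) (h' : Nice T σ) :
    Nice T (fun ω => min (τ ω) (σ ω)) where
  nn ω := le_min (h.nn ω) (h'.nn ω)
  le ω := (min_le_left _ _).trans (h.le ω)
  st t ht := by
    have : {ω | Min.min (τ ω) (σ ω) ≤ t} = {ω | τ ω ≤ t} ∪ {ω | σ ω ≤ t} := by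
      ext ω; simp
    rw [this]; exact (h.st t ht).union (h'.st t ht)

lemma Nice.max {τ σ : Path T → ℝ} (h : Nice T τ) (h' : Nice T σ) :
    Nice T (fun ω => max (τ ω) (σ ω)) where
  nn ω := (h.nn ω).trans (le_max_left _ _)
  le ω := max_le (h.le ω) (h'.le ω)
  st t ht := by
    have : {ω | Max.max (τ ω) (σ ω) ≤ t} = {ω | τ ω ≤ t} ∩ {ω | σ ω ≤ t} := by
      ext ω; simp
    rw [this]; exact (h.st t ht).inter (h'.st t ht)

lemma Nice.zero (hT : 0 ≤ T) : Nice T (fun _ => 0) where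
  nn _ := le_rfl
  le _ := hT
  st t ht := by
    have : {ω : Path T | (0:ℝ) ≤ t} = univ := by ext; simp [ht.1]
    rw [this]; exact MeasurableSet.univ

lemma Nice.min_meas {τ : Path T → ℝ} (h : Nice T τ) {t : ℝ} (ht : t ∈ Icc (0:ℝ) T) :
    Measurable[Fplus T t] (fun ω => Min.min (τ ω) t) := by
  refine measurable_of_Iic fun s => ?_
  rcases le_or_gt t s with hs | hs
  · have : (fun ω => Min.min (τ ω) t) ⁻¹' Iic s = univ := by ext; simp [hs]
    rw [this]; exact MeasurableSet.univ
  · rcases le_or_gt 0 s with h0 | h0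
    · have : (fun ω => Min.min (τ ω) t) ⁻¹' Iic s = {ω | τ ω ≤ s} := by
        ext ω; simp [hs]
      rw [this]
      exact Fplus_mono T hs.le _ (h.st s ⟨h0, hs.le.trans ht.2⟩)
    · have : (fun ω => Min.min (τ ω) t) ⁻¹' Iic s = ∅ := by
        ext ω
        simp only [mem_preimage, mem_Iic, mem_empty_iff_false, iff_false, not_le]
        exact lt_min (h0.trans_le (h.nn ω)) hs
      rw [this]; exact @MeasurableSet.empty _ (Fplus T t)

lemma meas_iff {τ f : Path T → ℝ} (h : Nice T τ) :
    MeasAtStopPlus T τ f ↔ ∀ t ∈ Icc (0:ℝ) T,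
      Measurable[Fplus T t] (fun ω => if τ ω ≤ t then f ω else 0) := by
  constructor
  · intro H t ht B hB
    have : (fun ω => if τ ω ≤ t then f ω else 0) ⁻¹' B =
        (f ⁻¹' B ∩ {ω | τ ω ≤ t}) ∪ ({ω | τ ω ≤ t}ᶜ ∩ {ω | (0:ℝ) ∈ B}) := by
      ext ω
      by_cases h : τ ω ≤ t <;> simp [h]
    rw [this]
    refine (H B hB t ht).union ((h.st t ht).compl.inter ?_)
    by_cases h0 : (0:ℝ) ∈ B
    · simp [h0]
    · simp [h0]
  · intro H B hB t ht
    have : f ⁻¹' B ∩ {ω | τ ω ≤ t} =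
        (fun ω => if τ ω ≤ t then f ω else 0) ⁻¹' B ∩ {ω | τ ω ≤ t} := by
      ext ω
      by_cases h : τ ω ≤ t <;> simp [h]
    rw [this]
    exact (H t ht hB).inter (h.st t ht)

lemma ev_cont (hT : 0 ≤ T) (ω : Path T) : Continuous (ev T hT ω) :=
  ω.continuous.comp (continuous_projIcc (h := hT))

lemma ev_meas_const (hT : 0 ≤ T) {s t : ℝ} (ht : t ∈ Icc (0:ℝ) T) (hs : s ≤ t) :
    Measurable[Fplus T t] (fun ω => ev T hT ω s) := by
  have hle : ((clamp T hT s : Icc (0:ℝ) T) : ℝ) ≤ t := by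
    simp only [clamp, coe_projIcc]
    exact max_le ht.1 ((min_le_right _ _).trans hs)
  have h1 : Fraw T t ≤ Fplus T t := by
    unfold Fplus
    refine le_iInf₂ fun u hu => ?_
    unfold Fraw
    refine iSup₂_le fun v hv => ?_
    exact le_iSup₂_of_le v (hv.trans (le_min hu.le ht.2)) le_rfl
  have h2 : MeasurableSpace.comap (fun ω : Path T => ω (clamp T hT s)) inferInstance ≤ Fraw T t :=
    le_iSup₂_of_le (clamp T hT s) hle le_rfl
  intro B hB
  exact h1 _ (h2 _ ⟨B, hB, rfl⟩)

lemma ev_meas (hT : 0 ≤ T) {τ : Path T → ℝ} (h : Nice T τ) {t : ℝ} (ht : t ∈ Icc (0:ℝ) T) :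
    Measurable[Fplus T t] (fun ω => ev T hT ω (Min.min (τ ω) t)) := by
  have h1 := @measurable_uncurry_of_continuous_of_measurable (Path T) ℝ ℝ _ _ _ _ _ _ _ _ _
    (Fplus T t) (fun i ω => ev T hT ω (Min.min i t))
    (fun ω => (ev_cont hT ω).comp (continuous_id.min continuous_const))
    (fun i => ev_meas_const hT ht (min_le_right _ _))
  have h2 := h1.comp ((h.min_meas ht).prodMk (@measurable_id _ (Fplus T t)))
  have : (fun ω => ev T hT ω (Min.min (τ ω) t)) =
    (Function.uncurry fun i ω => ev T hT ω (Min.min i t)) ∘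
      fun a => (Min.min (τ a) t, id a) := by
    ext ω; simp [Function.uncurry]
  rw [this]; exact h2

lemma le_meas {a θ : Path T → ℝ} (ha : Nice T a) (hθ : Nice T θ) {t : ℝ} (ht : t ∈ Icc (0:ℝ) T) :
    MeasurableSet[Fplus T t] {ω | a ω ≤ θ ω ∧ a ω ≤ t} := by
  have : {ω | a ω ≤ θ ω ∧ a ω ≤ t} =
      {ω | Min.min (a ω) t ≤ Min.min (θ ω) t} ∩ {ω | a ω ≤ t} := by
    ext ω
    simp only [mem_ofPred_eq, mem_inter_iff]
    constructor
    · rintro ⟨h1, h2⟩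
      exact ⟨min_le_min_right _ h1, h2⟩
    · rintro ⟨h1, h2⟩
      rw [min_eq_left h2] at h1
      exact ⟨h1.trans (min_le_left _ _), h2⟩
  rw [this]
  exact (measurableSet_le (ha.min_meas ht) (hθ.min_meas ht)).inter (ha.st t ht)

lemma lt_meas {b θ : Path T → ℝ} (hb : Nice T b) (hθ : Nice T θ) {t : ℝ} (ht : t ∈ Icc (0:ℝ) T) :
    MeasurableSet[Fplus T t] {ω | θ ω < b ω ∧ θ ω ≤ t} := by
  have : {ω | θ ω < b ω ∧ θ ω ≤ t} =
      {ω | θ ω ≤ t} \ {ω | b ω ≤ θ ω ∧ b ω ≤ t} := by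
    ext ω
    simp only [mem_ofPred_eq, Set.mem_sdiff, not_and, not_le]
    constructor
    · rintro ⟨h1, h2⟩
      exact ⟨h2, fun h => absurd h (not_le.2 h1)⟩
    · rintro ⟨h1, h2⟩
      refine ⟨?_, h1⟩
      by_contra h
      push Not at h
      have := h2 h
      linarith
  rw [this]
  exact (hθ.st t ht).diff (le_meas hb hθ ht)

/-- elementary strategy `h 1_{(a,b]}` -/
structure Elem (T : ℝ) where
  a : Path T → ℝ
  b : Path T → ℝ
  h : Path T → ℝ
  na : Nice T a
  nb : Nice T b
  hab : ∀ ω, a ω ≤ b ω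
  bdd : ∃ C : ℝ, ∀ ω, |h ω| ≤ C
  hm : MeasAtStopPlus T a h

/-- gains of an elementary strategy -/
def Elem.V (hT : 0 ≤ T) (e : Elem T) (t : ℝ) (ω : Path T) : ℝ :=
  e.h ω * (ev T hT ω (Min.min (e.b ω) t) - ev T hT ω (Min.min (e.a ω) t))

lemma Elem.V_cont (hT : 0 ≤ T) (e : Elem T) (ω : Path T) : Continuous fun t => e.V hT t ω := by
  unfold Elem.V
  exact continuous_const.mul
    (((ev_cont hT ω).comp (continuous_const.min continuous_id)).sub
    ((ev_cont hT ω).comp (continuous_const.min continuous_id)))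

lemma Elem.V_zero (hT : 0 ≤ T) (e : Elem T) (ω : Path T) : e.V hT 0 ω = 0 := by
  unfold Elem.V
  rw [min_eq_right (e.na.nn ω), min_eq_right (e.nb.nn ω)]; simp

lemma Elem.V_meas (hT : 0 ≤ T) (e : Elem T) {t : ℝ} (ht : t ∈ Icc (0:ℝ) T) :
    Measurable[Fplus T t] (e.V hT t) := by
  have h1 := ((meas_iff e.na).1 e.hm t ht).mul ((ev_meas hT e.nb ht).sub (ev_meas hT e.na ht))
  convert h1 using 1
  ext ω
  simp only [Elem.V, Pi.mul_apply, Pi.sub_apply]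
  by_cases h : e.a ω ≤ t
  · simp [h]
  · simp only [h, if_false, zero_mul]
    have h2 := e.hab ω
    rw [min_eq_right (by linarith), min_eq_right (by linarith)]; simp

/-- the elementary strategy stopped at `ρ` -/
def Elem.halt (e : Elem T) (ρ : Path T → ℝ) (hρ : Nice T ρ) : Elem T where
  a ω := Min.min (e.a ω) (ρ ω)
  b ω := Min.min (e.b ω) (ρ ω)
  h ω := if e.a ω ≤ ρ ω then e.h ω else 0
  na := e.na.min hρ
  nb := e.nb.min hρ
  hab ω := min_le_min_right _ (e.hab ω)
  bdd := by
    obtain ⟨C, hC⟩ := e.bdd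
    refine ⟨C, fun ω => ?_⟩
    split_ifs
    · exact hC ω
    · simpa using (abs_nonneg _).trans (hC ω)
  hm := by
    rw [meas_iff (e.na.min hρ)]
    intro t ht
    have h1 : Measurable[Fplus T t] (fun ω => if e.a ω ≤ ρ ω ∧ e.a ω ≤ t then
        (if e.a ω ≤ t then e.h ω else 0) else 0) := Measurable.ite (le_meas e.na hρ ht) ((meas_iff e.na).1 e.hm t ht)
      (@measurable_const _ _ _ (Fplus T t) (0:ℝ))
    convert h1 using 1
    ext ω
    simp only [min_le_iff]
    by_cases h1 : e.a ω ≤ ρ ω <;> by_cases h2 : e.a ω ≤ t <;> simp [h1, h2]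
    intro h3; linarith

lemma Elem.halt_V (hT : 0 ≤ T) (e : Elem T) (ρ : Path T → ℝ) (hρ : Nice T ρ) (t : ℝ) (ω : Path T) :
    (e.halt ρ hρ).V hT t ω = e.V hT (Min.min (ρ ω) t) ω := by
  simp only [Elem.V, Elem.halt, min_assoc]
  split_ifs with h
  · rfl
  · push Not at h
    have h2 := e.hab ω
    have h3 : Min.min (ρ ω) t ≤ ρ ω := min_le_left _ _
    rw [min_eq_right (h3.trans (by linarith)), min_eq_right (h3.trans (by linarith))]; simp

lemma sort_le_iff {n : ℕ} (f : Fin n → ℝ) (j : Fin n) (t : ℝ) :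
    f (Tuple.sort f j) ≤ t ↔ ∃ s : Finset (Fin n), (j:ℕ) < s.card ∧ ∀ i ∈ s, f i ≤ t := by
  constructor
  · intro h
    refine ⟨(Finset.Iic j).map (Tuple.sort f).toEmbedding, by simp, ?_⟩
    intro i hi
    simp only [Finset.mem_map, Finset.mem_Iic] at hi
    obtain ⟨k, hk, rfl⟩ := hi
    exact (Tuple.monotone_sort f hk).trans h
  · rintro ⟨s, hs, hst⟩
    by_contra hlt
    push Not at hlt
    have : s ⊆ (Finset.Iio j).map (Tuple.sort f).toEmbedding := by
      intro i hi
      simp only [Finset.mem_map, Finset.mem_Iio]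
      refine ⟨(Tuple.sort f).symm i, ?_, by simp⟩
      by_contra hc
      push Not at hc
      have h1 := Tuple.monotone_sort f hc
      simp only [Function.comp, Equiv.apply_symm_apply] at h1
      have := hst i hi
      linarith
    have := Finset.card_le_card this
    simp at this
    omega

lemma Nice.sort {n : ℕ} {g : Fin n → Path T → ℝ} (hg : ∀ i, Nice T (g i)) (j : Fin n) :
    Nice T (fun ω => g (Tuple.sort (fun i => g i ω) j) ω) where
  nn ω := (hg _).nn ω
  le ω := (hg _).le ω
  st t ht := by
    have : {ω | g (Tuple.sort (fun i => g i ω) j) ω ≤ t} =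
        ⋃ (s : Finset (Fin n)) (_ : (j:ℕ) < s.card), ⋂ (i : Fin n) (_ : i ∈ s), {ω | g i ω ≤ t} := by
      ext ω
      have := sort_le_iff (fun i => g i ω) j t
      simp only [mem_ofPred_eq, mem_iUnion, mem_iInter, exists_prop]
      exact this
    rw [this]
    refine MeasurableSet.iUnion fun s => MeasurableSet.iUnion fun _ =>
      MeasurableSet.iInter fun i => MeasurableSet.iInter fun _ => (hg i).st t ht

lemma tele {n : ℕ} (θ : Fin (n + 1) → ℝ) (hθ : Monotone θ) (a b : ℝ) (hab : a ≤ b)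
    (ha : ∃ p, θ p = a) (hb : ∃ p, θ p = b) (S : ℝ → ℝ) :
    ∑ j : Fin n, (if a ≤ θ j.castSucc ∧ θ j.castSucc < b then (1:ℝ) else 0) *
      (S (θ j.succ) - S (θ j.castSucc)) = S b - S a := by
  obtain ⟨p, rfl⟩ := ha
  obtain ⟨q, rfl⟩ := hb
  have key : ∀ j : Fin n, (if θ p ≤ θ j.castSucc ∧ θ j.castSucc < θ q then (1:ℝ) else 0) *
      (S (θ j.succ) - S (θ j.castSucc)) =
      S (Min.min (θ q) (Max.max (θ p) (θ j.succ))) -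
        S (Min.min (θ q) (Max.max (θ p) (θ j.castSucc))) := by
    intro j
    have hstep : ∀ r : Fin (n+1), θ j.castSucc < θ r → θ j.succ ≤ θ r := by
      intro r hr
      have : j.castSucc < r := by
        by_contra hc
        push Not at hc
        have := hθ hc
        linarith
      exact hθ (Fin.castSucc_lt_iff_succ_le.1 this)
    have hm : θ j.castSucc ≤ θ j.succ := hθ (Fin.castSucc_lt_succ).le
    by_cases h1 : θ p ≤ θ j.castSucc
    · by_cases h2 : θ j.castSucc < θ q
      · rw [if_pos ⟨h1, h2⟩, max_eq_right h1, max_eq_right (h1.trans hm),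
          min_eq_right h2.le, min_eq_right (hstep q h2), one_mul]
      · rw [if_neg (fun h => h2 h.2)]
        push Not at h2
        rw [max_eq_right h1, max_eq_right (h1.trans hm), min_eq_left h2,
          min_eq_left (h2.trans hm)]; simp
    · rw [if_neg (fun h => h1 h.1)]
      push Not at h1
      rw [max_eq_left h1.le, max_eq_left (hstep p h1)]; simp
  rw [Finset.sum_congr rfl fun j _ => key j]
  have h2 := Fin.sum_univ_castSucc (fun j : Fin (n+1) => S (Min.min (θ q) (Max.max (θ p) (θ j))))
  have h3 := Fin.sum_univ_succ (fun j : Fin (n+1) => S (Min.min (θ q) (Max.max (θ p) (θ j))))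
  rw [Finset.sum_sub_distrib]
  have e1 : Min.min (θ q) (Max.max (θ p) (θ (Fin.last n))) = θ q := by
    rw [max_eq_right (hθ (Fin.le_last _)), min_eq_left (hθ (Fin.le_last _))]
  have e0 : Min.min (θ q) (Max.max (θ p) (θ 0)) = θ p := by
    rw [max_eq_left (hθ (Fin.zero_le _)), min_eq_right hab]
  rw [e1] at h2
  rw [e0] at h3
  linarith

lemma exists_strategy (hT : 0 ≤ T) {ι : Type} [Fintype ι] (E : ι → Elem T) :
    ∃ K : SimpleStrategy T, ∀ t ω, integ T K (Sproc T hT) t ω = ∑ i, (E i).V hT t ω := by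
  obtain ⟨L, ⟨e⟩⟩ : ∃ L : ℕ, Nonempty (Option (ι ⊕ ι) ≃ Fin (L + 1)) := by
    refine ⟨Fintype.card (ι ⊕ ι), ⟨Fintype.equivFinOfCardEq ?_⟩⟩
    simp
  let g0 : Option (ι ⊕ ι) → Path T → ℝ := fun o => match o with
    | none => fun _ => 0
    | some (Sum.inl i) => (E i).a
    | some (Sum.inr i) => (E i).b
  have hg0 : ∀ o, Nice T (g0 o) := by
    rintro (_ | i | i)
    · exact Nice.zero hT
    · exact (E i).na
    · exact (E i).nb
  let g : Fin (L+1) → Path T → ℝ := fun i => g0 (e.symm i)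
  have hg : ∀ i, Nice T (g i) := fun i => hg0 _
  let θ : Fin (L+1) → Path T → ℝ := fun j ω => g (Tuple.sort (fun i => g i ω) j) ω
  have hθ : ∀ j, Nice T (θ j) := fun j => Nice.sort hg j
  have hmono : ∀ ω, Monotone fun j => θ j ω := fun ω => Tuple.monotone_sort (fun i => g i ω)
  have hmem : ∀ o ω, ∃ p, θ p ω = g0 o ω := by
    intro o ω
    refine ⟨(Tuple.sort (fun i => g i ω)).symm (e o), ?_⟩
    simp [θ, g]
  let c : Fin L → Path T → ℝ := fun j ω =>
    ∑ i, if (E i).a ω ≤ θ j.castSucc ω ∧ θ j.castSucc ω < (E i).b ω then (E i).h ω else 0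
  refine ⟨⟨L, θ, c, (hθ 0).nn, fun l ω => hmono ω (Fin.castSucc_lt_succ).le,
    (hθ _).le, fun l => (hθ l).st, ?_, ?_⟩, ?_⟩
  · intro l
    choose C hC using fun i => (E i).bdd
    refine ⟨∑ i, C i, fun ω => (Finset.abs_sum_le_sum_abs _ _).trans (Finset.sum_le_sum ?_)⟩
    intro i _
    split_ifs
    · exact hC i ω
    · simpa using (abs_nonneg _).trans (hC i ω)
  · intro l
    rw [meas_iff (hθ _)]
    intro t ht
    have : (fun ω => if θ l.castSucc ω ≤ t then c l ω else 0) = fun ω => ∑ i,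
        if θ l.castSucc ω < (E i).b ω ∧ θ l.castSucc ω ≤ t then
          (if (E i).a ω ≤ θ l.castSucc ω ∧ (E i).a ω ≤ t then
            (if (E i).a ω ≤ t then (E i).h ω else 0) else 0) else 0 := by
      ext ω
      by_cases h : θ l.castSucc ω ≤ t
      · simp only [h, if_true, c]
        refine Finset.sum_congr rfl fun i _ => ?_
        by_cases h1 : (E i).a ω ≤ θ l.castSucc ω
        · have := h1.trans h
          simp [h1, this]
        · simp [h1]
      · simp [h]
    rw [this]
    refine Finset.measurable_sum _ fun i _ => ?_
    exact Measurable.ite (lt_meas (E i).nb (hθ _) ht)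
      (Measurable.ite (le_meas (E i).na (hθ _) ht) ((meas_iff (E i).na).1 (E i).hm t ht)
      (@measurable_const _ _ _ (Fplus T t) (0:ℝ))) (@measurable_const _ _ _ (Fplus T t) (0:ℝ))
  · intro t ω
    simp only [integ, c, Finset.sum_mul]
    rw [Finset.sum_comm]
    refine Finset.sum_congr rfl fun i _ => ?_
    have := tele (fun j => θ j ω) (hmono ω) ((E i).a ω) ((E i).b ω) ((E i).hab ω)
      (hmem (some (Sum.inl i)) ω) (hmem (some (Sum.inr i)) ω)
      (fun s => ev T hT ω (Min.min s t))
    simp only [Elem.V, ← this, Finset.mul_sum, Sproc]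
    refine Finset.sum_congr rfl fun j _ => ?_
    split_ifs <;> ring

lemma hit_attained (X : ℝ → ℝ) (hc : Continuous X) (c M t : ℝ) (hM : t < M)
    (h : sInf ({s : ℝ | c ≤ s ∧ s ≤ T ∧ X s ≤ 0} ∪ {M}) ≤ t) :
    sInf ({s : ℝ | c ≤ s ∧ s ≤ T ∧ X s ≤ 0} ∪ {M}) ∈ {s : ℝ | c ≤ s ∧ s ≤ T ∧ X s ≤ 0} := by
  have hcl : IsClosed ({s : ℝ | c ≤ s ∧ s ≤ T ∧ X s ≤ 0} ∪ {M}) := by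
    refine IsClosed.union ?_ isClosed_singleton
    have : {s : ℝ | c ≤ s ∧ s ≤ T ∧ X s ≤ 0} = Icc c T ∩ {s | X s ≤ 0} := by
      ext; simp [and_assoc]
    rw [this]
    exact isClosed_Icc.inter (isClosed_le hc continuous_const)
  have hbd : BddBelow ({s : ℝ | c ≤ s ∧ s ≤ T ∧ X s ≤ 0} ∪ {M}) := by
    refine BddBelow.union ⟨c, fun s hs => hs.1⟩ bddBelow_singleton
  rcases hcl.csInf_mem ⟨M, Or.inr rfl⟩ hbd with h1 | h1
  · exact h1
  · rw [mem_singleton_iff] at h1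
    linarith

lemma hit_le (X : ℝ → ℝ) (c M s : ℝ) (hs : c ≤ s ∧ s ≤ T ∧ X s ≤ 0) :
    sInf ({s : ℝ | c ≤ s ∧ s ≤ T ∧ X s ≤ 0} ∪ {M}) ≤ s :=
  csInf_le (BddBelow.union ⟨c, fun s hs => hs.1⟩ bddBelow_singleton) (Or.inl hs)

/-- first time a process is nonpositive -/
def rho (X : ℝ → Path T → ℝ) (ω : Path T) : ℝ :=
  sInf ({s : ℝ | 0 ≤ s ∧ s ≤ T ∧ X s ω ≤ 0} ∪ {T})

lemma rho_nice (hT : 0 ≤ T) (X : ℝ → Path T → ℝ) (hc : ∀ ω, Continuous fun s => X s ω)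
    (hm : ∀ s ∈ Icc (0:ℝ) T, Measurable[Fplus T s] (X s)) : Nice T (rho X) where
  nn ω := by
    refine le_csInf ⟨T, Or.inr rfl⟩ ?_
    rintro s (hs | hs)
    · exact hs.1
    · rw [mem_singleton_iff] at hs; rw [hs]; exact hT
  le ω := csInf_le (BddBelow.union ⟨0, fun s hs => hs.1⟩ bddBelow_singleton) (Or.inr rfl)
  st t ht := by
    rcases ht.2.eq_or_lt with h | h
    · have : {ω | rho X ω ≤ t} = univ := by
        ext ω
        simp only [mem_ofPred_eq, mem_univ, iff_true]
        rw [h]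
        exact csInf_le (BddBelow.union ⟨0, fun s hs => hs.1⟩ bddBelow_singleton) (Or.inr rfl)
      rw [this]; exact MeasurableSet.univ
    · have : {ω | rho X ω ≤ t} = {ω | ∃ s ∈ Icc (0:ℝ) t, X s ω ≤ 0} := by
        ext ω
        simp only [mem_ofPred_eq]
        constructor
        · intro h1
          have h2 := hit_attained (fun s => X s ω) (hc ω) 0 T t h h1
          exact ⟨_, ⟨h2.1, h1⟩, h2.2.2⟩
        · rintro ⟨s, hs, hX⟩
          exact (hit_le (fun s => X s ω) 0 T s ⟨hs.1, hs.2.trans ht.2, hX⟩).trans hs.2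
      rw [this]
      refine @hit_meas _ (Fplus T t) X hc t ht.1 fun s hs => ?_
      exact (hm s ⟨hs.1, hs.2.trans ht.2⟩).mono (Fplus_mono T hs.2) le_rfl

lemma rho_nonneg (X : ℝ → Path T → ℝ) (hc : ∀ ω, Continuous fun s => X s ω)
    (ω : Path T) (h0 : 0 < X 0 ω) (s : ℝ) (hs0 : 0 ≤ s) (hsT : s ≤ T) (hs : s ≤ rho X ω) :
    0 ≤ X s ω := by
  by_contra hneg
  push Not at hneg
  have := intermediate_value_Icc' hs0 ((hc ω).continuousOn (s := Icc 0 s))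
  obtain ⟨u, hu, hXu⟩ := this ⟨hneg.le, h0.le⟩
  simp only at hXu
  have hne : u ≠ s := by rintro rfl; linarith
  have hlt : u < s := lt_of_le_of_ne hu.2 hne
  have := hit_le (fun s => X s ω) 0 T u ⟨hu.1, hu.2.trans hsT, hXu.le⟩
  unfold rho at hs
  linarith

lemma rho_eq (X : ℝ → Path T → ℝ) (ω : Path T) (h : ∀ s ∈ Icc (0:ℝ) T, 0 < X s ω) :
    rho X ω = T := by
  have : {s : ℝ | 0 ≤ s ∧ s ≤ T ∧ X s ω ≤ 0} = ∅ := by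
    ext s
    simp only [mem_ofPred_eq, mem_empty_iff_false, iff_false]
    rintro ⟨h1, h2, h3⟩
    have := h s ⟨h1, h2⟩
    linarith
  rw [rho, this]; simp

section sigs
variable (hT : 0 ≤ T)

lemma sig_succ (m k : ℕ) (ω : Path T) : sig T hT m (k+1) ω =
    sInf ({s : ℝ | sig T hT m k ω ≤ s ∧ s ≤ T ∧
      ((2:ℝ) ^ (-(m:ℤ)) - |ev T hT ω s - ev T hT ω (sig T hT m k ω)|) ≤ 0} ∪ {T+1}) := by
  simp only [sub_nonpos]
  rfl

lemma sig_le (m k : ℕ) (ω : Path T) : sig T hT m k ω ≤ T + 1 := by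
  cases k with
  | zero => simp only [sig]; linarith
  | succ k =>
    rw [sig_succ]
    exact csInf_le (BddBelow.union ⟨_, fun s hs => hs.1⟩ bddBelow_singleton) (Or.inr rfl)

lemma sig_mono (m k : ℕ) (ω : Path T) : sig T hT m k ω ≤ sig T hT m (k+1) ω := by
  rw [sig_succ]
  refine le_csInf ⟨T+1, Or.inr rfl⟩ ?_
  rintro s (hs | hs)
  · exact hs.1
  · rw [mem_singleton_iff] at hs; rw [hs]; exact sig_le hT m k ω

lemma sig_monotone (m : ℕ) (ω : Path T) : Monotone fun k => sig T hT m k ω :=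
  monotone_nat_of_le_succ fun k => sig_mono hT m k ω

lemma sig_nonneg (m k : ℕ) (ω : Path T) : 0 ≤ sig T hT m k ω :=
  sig_monotone hT m ω (Nat.zero_le k)

lemma sig_att (m k : ℕ) (ω : Path T) (h : sig T hT m (k+1) ω ≤ T) :
    (2:ℝ) ^ (-(m:ℤ)) ≤
      |ev T hT ω (sig T hT m (k+1) ω) - ev T hT ω (sig T hT m k ω)| := by
  have h1 := h
  rw [sig_succ] at h1
  have := hit_attained (T := T)
    (fun s => (2:ℝ) ^ (-(m:ℤ)) - |ev T hT ω s - ev T hT ω (sig T hT m k ω)|)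
    (continuous_const.sub ((ev_cont hT ω).sub continuous_const).abs)
    (sig T hT m k ω) (T+1) T (by linarith) h1
  rw [← sig_succ] at this
  exact sub_nonpos.1 this.2.2

lemma sig_ev (m : ℕ) (ω : Path T) : ∃ N, T ≤ sig T hT m N ω := by
  by_contra hcon
  push Not at hcon
  have hlim := tendsto_atTop_ciSup (sig_monotone hT m ω)
    ⟨T+1, by rintro _ ⟨k, rfl⟩; exact sig_le hT m k ω⟩
  have h1 := ((ev_cont hT ω).tendsto _).comp hlim
  have h2 := h1.comp (tendsto_add_atTop_nat 1)
  have h3 := (h2.sub h1).abs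
  have h4 := ge_of_tendsto' h3 (b := (2:ℝ) ^ (-(m:ℤ))) fun k => sig_att hT m k ω (hcon (k+1)).le
  have h5 : (0:ℝ) < (2:ℝ) ^ (-(m:ℤ)) := by positivity
  rw [sub_self, abs_zero] at h4
  linarith

/-- capped stopping times -/
def sc (m k : ℕ) (ω : Path T) : ℝ := Min.min (sig T hT m k ω) T

lemma ev_cap (ω : Path T) (s : ℝ) : ev T hT ω (Min.min s T) = ev T hT ω s := by
  unfold ev clamp
  congr 1
  ext
  simp [coe_projIcc, min_comm]

lemma sc_nice (m k : ℕ) : Nice T (sc hT m k) := by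
  induction k with
  | zero =>
    have : sc hT m 0 = fun _ => 0 := by
      ext ω; simp [sc, sig, hT]
    rw [this]; exact Nice.zero hT
  | succ k ih =>
    refine ⟨fun ω => le_min (sig_nonneg hT m _ ω) hT, fun ω => min_le_right _ _, ?_⟩
    intro t ht
    rcases ht.2.eq_or_lt with h | h
    · have : {ω | sc hT m (k+1) ω ≤ t} = univ := by
        ext ω; simp [sc, h]
      rw [this]; exact MeasurableSet.univ
    · let X : ℝ → Path T → ℝ := fun s ω =>
        (2:ℝ) ^ (-(m:ℤ)) - |ev T hT ω s - ev T hT ω (Min.min (sc hT m k ω) s)|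
      have hXc : ∀ ω, Continuous fun s => X s ω := fun ω =>
        continuous_const.sub ((ev_cont hT ω).sub
          ((ev_cont hT ω).comp (continuous_const.min continuous_id))).abs
      have h5 : (0:ℝ) < (2:ℝ) ^ (-(m:ℤ)) := by positivity
      have hX : ∀ s ω, s ≤ T → sig T hT m k ω ≤ s →
          X s ω = (2:ℝ) ^ (-(m:ℤ)) - |ev T hT ω s - ev T hT ω (sig T hT m k ω)| := by
        intro s ω hs h1
        simp only [X, sc]
        rw [min_assoc, min_eq_right hs, min_eq_left h1]
      have hX' : ∀ s ω, s ≤ T → X s ω ≤ 0 → sig T hT m k ω ≤ s := by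
        intro s ω hs h1
        by_contra hc
        push Not at hc
        simp only [X, sc] at h1
        rw [min_assoc, min_eq_right hs, min_eq_right hc.le] at h1
        rw [sub_self, abs_zero] at h1
        linarith
      have : {ω | sc hT m (k+1) ω ≤ t} = {ω | ∃ s ∈ Icc (0:ℝ) t, X s ω ≤ 0} := by
        ext ω
        simp only [mem_ofPred_eq, sc, min_le_iff, not_le.2 h, or_false]
        constructor
        · intro h1
          have h2 := sig_att hT m k ω (h1.trans h.le)
          refine ⟨sig T hT m (k+1) ω, ⟨sig_nonneg hT m _ ω, h1⟩, ?_⟩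
          rw [hX _ _ (h1.trans h.le) (sig_mono hT m k ω)]
          linarith
        · rintro ⟨s, hs, hXs⟩
          have hsT := hs.2.trans ht.2
          have h1 := hX' s ω hsT hXs
          rw [hX s ω hsT h1] at hXs
          rw [sig_succ]
          exact (hit_le (T := T)
            (fun s => (2:ℝ) ^ (-(m:ℤ)) - |ev T hT ω s - ev T hT ω (sig T hT m k ω)|)
            _ (T+1) s ⟨h1, hsT, hXs⟩).trans hs.2
      rw [this]
      refine @hit_meas _ (Fplus T t) X hXc t ht.1 fun s hs => ?_
      have hsT : s ∈ Icc (0:ℝ) T := ⟨hs.1, hs.2.trans ht.2⟩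
      have hmm : Measurable[Fplus T s] (X s) := by
        refine measurable_const.sub ?_
        exact measurable_norm.comp ((ev_meas_const hT hsT le_rfl).sub (ev_meas hT ih hsT))
      exact hmm.mono (Fplus_mono T hs.2) le_rfl

/-- truncation -/
def clip (n : ℕ) (x : ℝ) : ℝ := Max.max (-(n:ℝ)) (Min.min x n)

lemma clip_abs (n : ℕ) (x : ℝ) : |clip n x| ≤ n := by
  rw [abs_le]
  refine ⟨le_max_left _ _, max_le ?_ (min_le_right _ _)⟩
  have : (0:ℝ) ≤ n := Nat.cast_nonneg n
  linarith

lemma clip_eq (n : ℕ) (x : ℝ) (h : |x| ≤ n) : clip n x = x := by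
  rw [abs_le] at h
  rw [clip, min_eq_left h.2, max_eq_right h.1]

lemma clip_cont (n : ℕ) : Continuous (clip n) :=
  continuous_const.max (continuous_id.min continuous_const)

lemma strat_nice (H : SimpleStrategy T) (l : Fin (H.L + 1)) : Nice T (H.τ l) := by
  have hm : ∀ ω, Monotone fun l => H.τ l ω := fun ω =>
    Fin.monotone_iff_le_succ.2 fun l => H.τ_mono l ω
  refine ⟨fun ω => (H.τ_nonneg ω).trans (hm ω (Fin.zero_le l)),
    fun ω => (hm ω (Fin.le_last l)).trans (H.τ_le ω), ?_⟩
  cases H with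
  | mk L τ c h1 h2 h3 h4 h5 h6 => exact h4 l

/-- the pieces of a simple strategy -/
def elemH (H : SimpleStrategy T) (l : Fin H.L) : Elem T where
  a := H.τ l.castSucc
  b := H.τ l.succ
  h := H.coeff l
  na := strat_nice H _
  nb := strat_nice H _
  hab := H.τ_mono l
  bdd := H.coeff_bdd l
  hm := H.coeff_meas l

lemma elemH_sum (H : SimpleStrategy T) (t : ℝ) (ω : Path T) :
    ∑ l, (elemH H l).V hT t ω = integ T H (Sproc T hT) t ω := rfl

/-- the pieces of `G · 𝕊^m` -/
def elemG (G : SimpleStrategy T) (m n : ℕ) (l : Fin G.L) (k : ℕ) : Elem T where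
  a ω := Max.max (G.τ l.castSucc ω) (sc hT m k ω)
  b ω := Max.max (Max.max (G.τ l.castSucc ω) (sc hT m k ω))
    (Min.min (G.τ l.succ ω) (sc hT m (k+1) ω))
  h ω := G.coeff l ω * clip n (ev T hT ω (sc hT m k ω))
  na := (strat_nice G _).max (sc_nice hT m k)
  nb := ((strat_nice G _).max (sc_nice hT m k)).max ((strat_nice G _).min (sc_nice hT m (k+1)))
  hab ω := le_max_left _ _
  bdd := by
    obtain ⟨C, hC⟩ := G.coeff_bdd l
    refine ⟨C * n, fun ω => ?_⟩
    rw [abs_mul]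
    exact mul_le_mul (hC ω) (clip_abs _ _) (abs_nonneg _) ((abs_nonneg _).trans (hC ω))
  hm := by
    have hn := (strat_nice G l.castSucc).max (sc_nice hT m k)
    rw [meas_iff hn]
    intro t ht
    have h1 : Measurable[Fplus T t] (fun ω =>
        if Max.max (G.τ l.castSucc ω) (sc hT m k ω) ≤ t then
        ((if G.τ l.castSucc ω ≤ t then G.coeff l ω else 0) *
          clip n (ev T hT ω (Min.min (sc hT m k ω) t))) else 0) :=
      Measurable.ite (hn.st t ht)
        (((meas_iff (strat_nice G _)).1 (G.coeff_meas l) t ht).mul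
          ((clip_cont n).measurable.comp (ev_meas hT (sc_nice hT m k) ht)))
        (@measurable_const _ _ _ (Fplus T t) (0:ℝ))
    convert h1 using 1
    ext ω
    by_cases h : Max.max (G.τ l.castSucc ω) (sc hT m k ω) ≤ t
    · rw [if_pos h, if_pos h, if_pos ((le_max_left _ _).trans h),
        min_eq_left ((le_max_right _ _).trans h)]
    · rw [if_neg h, if_neg h]

lemma four (S : ℝ → ℝ) (τ τ' σ σ' t : ℝ) (h : τ ≤ τ') (h' : σ ≤ σ') :
    S (min (max (max τ σ) (min τ' σ')) t) - S (min (max τ σ) t) =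
    (S (min σ' (min τ' t)) - S (min σ (min τ' t))) - (S (min σ' (min τ t)) - S (min σ (min τ t))) := by
  simp only [← min_assoc]
  rcases le_total σ' τ with h1 | h1
  · have h2 : σ ≤ τ := h'.trans h1
    rw [max_eq_left h2, min_eq_right (h1.trans h), max_eq_left h1, min_eq_left (h1.trans h),
      min_eq_left (h2.trans h), min_eq_left h1, min_eq_left h2]
    ring
  · rcases le_total τ' σ with h2 | h2
    · have h3 : τ ≤ σ := h.trans h2
      rw [max_eq_right h3, min_eq_left (h2.trans h'), max_eq_left h2, min_eq_right (h2.trans h'),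
        min_eq_right h2, min_eq_right h1, min_eq_right h3]
      ring
    · have h3 : max τ σ ≤ min τ' σ' := max_le (le_min h h1) (le_min h2 h')
      rw [max_eq_right h3, min_eq_left h2, min_eq_right h1, min_comm τ' σ']
      rcases le_total τ σ with h4 | h4
      · rw [max_eq_right h4, min_eq_right h4]; ring
      · rw [max_eq_left h4, min_eq_left h4]; ring

lemma Sm_eq (m N : ℕ) (ω : Path T) (hN : T ≤ sig T hT m N ω) (t : ℝ) (ht : t ≤ T) :
    Sm T hT m t ω = ∑ k ∈ Finset.range N, ev T hT ω (sig T hT m k ω) *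
    (ev T hT ω (min (sig T hT m (k + 1) ω) t) - ev T hT ω (min (sig T hT m k ω) t)) := by
  unfold Sm
  refine tsum_eq_sum fun k hk => ?_
  have hk : N ≤ k := by simpa using hk
  have h1 : t ≤ sig T hT m k ω := ht.trans (hN.trans (sig_monotone hT m ω hk))
  have h2 : t ≤ sig T hT m (k+1) ω := h1.trans (sig_mono hT m k ω)
  rw [min_eq_right h1, min_eq_right h2]; simp

lemma elemG_sum (G : SimpleStrategy T) (m n : ℕ) (ω : Path T) (hN : T ≤ sig T hT m n ω)
    (hn : ∀ s, |ev T hT ω s| ≤ n) (t : ℝ) (ht : t ≤ T) :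
    ∑ p : Fin G.L × Fin n, (elemG hT G m n p.1 p.2).V hT t ω = integ T G (Sm T hT m) t ω := by
  rw [Fintype.sum_prod_type]
  unfold integ
  refine Finset.sum_congr rfl fun l _ => ?_
  rw [Sm_eq hT m n ω hN _ ((min_le_right _ _).trans ht),
    Sm_eq hT m n ω hN _ ((min_le_right _ _).trans ht), ← Finset.sum_sub_distrib, Finset.mul_sum,
    Finset.sum_range]
  refine Finset.sum_congr rfl fun k _ => ?_
  simp only [Elem.V, elemG]
  rw [clip_eq _ _ (hn _), four (ev T hT ω) _ _ (sc hT m k ω) (sc hT m (k+1) ω) t (G.τ_mono l ω)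
    (min_le_min_right T (sig_mono hT m k ω))]
  have hc : ∀ k s, s ≤ T → Min.min (sc hT m k ω) s = Min.min (sig T hT m k ω) s := by
    intro k s hs
    rw [sc, min_assoc, min_eq_right hs]
  rw [hc _ _ ((min_le_right _ _).trans ht), hc _ _ ((min_le_right _ _).trans ht),
    hc _ _ ((min_le_right _ _).trans ht), hc _ _ ((min_le_right _ _).trans ht)]
  rw [sc, ev_cap]
  ring

lemma ev_bdd (ω : Path T) : ∃ N : ℕ, ∀ s, |ev T hT ω s| ≤ N := by
  obtain ⟨N, hN⟩ := exists_nat_ge ‖ω‖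
  exact ⟨N, fun s => (ω.norm_coe_le_norm _).trans hN⟩

end sigs

/-- key step -/
lemma stopped_GG (hT : 0 ≤ T) (Ξ : Set (Path T)) (c : ℝ) (hc : 0 < c) {ι : Type} [Fintype ι]
    (E : ι → Elem T) :
    ∃ Y : Path T → EReal, GG T hT Ξ c Y ∧ ∀ ω,
      (∀ s ∈ Icc (0:ℝ) T, 0 < c + ∑ i, (E i).V hT s ω) →
      Y ω = ((c + ∑ i, (E i).V hT T ω : ℝ) : EReal) := by
  let X : ℝ → Path T → ℝ := fun s ω => c + ∑ i, (E i).V hT s ω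
  have hXc : ∀ ω, Continuous fun s => X s ω := fun ω =>
    continuous_const.add (continuous_finsetSum _ fun i _ => (E i).V_cont hT ω)
  have hXm : ∀ s ∈ Icc (0:ℝ) T, Measurable[Fplus T s] (X s) := fun s hs =>
    measurable_const.add (Finset.measurable_sum _ fun i _ => (E i).V_meas hT hs)
  have hρ := rho_nice hT X hXc hXm
  obtain ⟨K, hK⟩ := exists_strategy hT fun i => (E i).halt (rho X) hρ
  have hK' : ∀ t ω, c + integ T K (Sproc T hT) t ω = X (min (rho X ω) t) ω := by
    intro t ω
    rw [hK]
    simp only [X, Elem.halt_V]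
  refine ⟨_, GG.base K ?_, ?_⟩
  · intro t ht ω _
    rw [hK']
    refine rho_nonneg X hXc ω ?_ _ (le_min (hρ.nn ω) ht.1) ((min_le_right _ _).trans ht.2)
      (min_le_left _ _)
    simp [X, Elem.V_zero, hc]
  · intro ω h
    simp only [hK']
    rw [rho_eq X ω h]
    simp [X]

lemma integ_zero (H : SimpleStrategy T) (X : ℝ → Path T → ℝ) (ω : Path T) :
    integ T H X 0 ω = 0 := by
  unfold integ
  refine Finset.sum_eq_zero fun l _ => ?_
  rw [min_eq_right ((strat_nice H _).nn ω), min_eq_right ((strat_nice H _).nn ω)]; simp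

lemma integ_close (G : SimpleStrategy T) : ∃ C : ℝ, 0 < C ∧
    ∀ (X X' : ℝ → Path T → ℝ) (δ : ℝ) (ω : Path T),
    (∀ s ∈ Icc (0:ℝ) T, |X s ω - X' s ω| ≤ δ) → ∀ t ∈ Icc (0:ℝ) T,
    integ T G X' t ω - C * δ ≤ integ T G X t ω := by
  choose C hC using G.coeff_bdd
  have hC0 : ∀ l, 0 ≤ C l := fun l => (abs_nonneg _).trans (hC l 0)
  refine ⟨2 * ∑ l, C l + 1, by have := Finset.sum_nonneg (fun l (_ : l ∈ Finset.univ) => hC0 l); linarith, ?_⟩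
  intro X X' δ ω h t ht
  have hδ : 0 ≤ δ := (abs_nonneg _).trans (h t ht)
  have key : integ T G X' t ω - integ T G X t ω ≤ ∑ l, C l * (2 * δ) := by
    unfold integ
    rw [← Finset.sum_sub_distrib]
    refine Finset.sum_le_sum fun l _ => ?_
    have h1 := h (min (G.τ l.succ ω) t)
      ⟨le_min ((strat_nice G _).nn ω) ht.1, (min_le_right _ _).trans ht.2⟩
    have h2 := h (min (G.τ l.castSucc ω) t)
      ⟨le_min ((strat_nice G _).nn ω) ht.1, (min_le_right _ _).trans ht.2⟩
    rw [← mul_sub]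
    refine (le_abs_self _).trans ?_
    rw [abs_mul]
    refine mul_le_mul (hC l ω) ?_ (abs_nonneg _) (hC0 l)
    rw [abs_le] at *
    constructor <;> linarith [h1.1, h1.2, h2.1, h2.2]
  rw [← Finset.sum_mul] at key
  nlinarith

end helpers

/-- **Lemma (the liminf-closure dominates `(H·S)_T + (G·𝕊)_T`).** If
`λ + (H·S)_t + (G·𝕊)_t ≥ 0` on `Ξ ⊆ Ω` for all `t`, then for every `ε > 0` there is
`Y ∈ 𝒢^Ξ_{λ+ε}` with `Y ≥ λ + (H·S)_T + (G·𝕊)_T` on `Ξ`. -/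
theorem liminf_closure_contains (T : ℝ) (hT : 0 ≤ T)
    (Ξ : Set (Path T)) (hΞ : Ξ ⊆ BigOmega T hT)
    (lam : ℝ) (H G : SimpleStrategy T)
    (hadm : ∀ t ∈ Set.Icc (0:ℝ) T, ∀ ω ∈ Ξ,
      0 ≤ lam + integ T H (Sproc T hT) t ω + integ T G (SS T hT) t ω)
    (ε : ℝ) (hε : 0 < ε) :
    ∃ Y : Path T → EReal, GG T hT Ξ (lam + ε) Y ∧
      ∀ ω ∈ Ξ,
        ((lam + integ T H (Sproc T hT) T ω + integ T G (SS T hT) T ω : ℝ) : EReal) ≤ Y ω := by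
  rcases Ξ.eq_empty_or_nonempty with rfl | ⟨ω0, hω0⟩
  · exact ⟨_, GG.base H (by simp), by simp⟩
  have hlam : 0 ≤ lam := by
    have := hadm 0 ⟨le_rfl, hT⟩ ω0 hω0
    rwa [integ_zero, integ_zero, add_zero, add_zero] at this
  have hc : 0 < lam + ε := by linarith
  choose Y hY hYe using fun m n : ℕ => stopped_GG hT Ξ (lam + ε) hc
    (Sum.elim (elemH H) (fun p : Fin G.L × Fin n => elemG hT G m n p.1 p.2))
  refine ⟨_, GG.lim _ fun m => GG.lim _ fun n => hY m n, ?_⟩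
  intro ω hω
  obtain ⟨C, hC, hclose⟩ := integ_close G
  have hunif := (Metric.tendstoUniformly_iff.1 (hΞ hω).1) (ε / (2 * C)) (by positivity)
  refine le_liminf_of_le (by isBoundedDefault) ?_
  filter_upwards [hunif] with m hm
  refine le_liminf_of_le (by isBoundedDefault) ?_
  obtain ⟨N1, hN1⟩ := sig_ev hT m ω
  obtain ⟨N2, hN2⟩ := ev_bdd hT ω
  filter_upwards [eventually_ge_atTop (max N1 N2)] with n hn
  have hs1 : T ≤ sig T hT m n ω :=
    hN1.trans (sig_monotone hT m ω ((le_max_left _ _).trans hn))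
  have hs2 : ∀ s, |ev T hT ω s| ≤ n := fun s =>
    (hN2 s).trans (by exact_mod_cast (le_max_right _ _).trans hn)
  have hsum : ∀ t, t ≤ T → ∑ i, (Sum.elim (elemH H)
      (fun p : Fin G.L × Fin n => elemG hT G m n p.1 p.2) i).V hT t ω =
      integ T H (Sproc T hT) t ω + integ T G (Sm T hT m) t ω := by
    intro t ht
    rw [Fintype.sum_sum_type]
    simp only [Sum.elim_inl, Sum.elim_inr]
    rw [elemG_sum hT G m n ω hs1 hs2 t ht, elemH_sum]
  have hcl : ∀ t ∈ Icc (0:ℝ) T,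
      integ T G (SS T hT) t ω - ε / 2 ≤ integ T G (Sm T hT m) t ω := by
    intro t ht
    have := hclose (Sm T hT m) (SS T hT) (ε / (2 * C)) ω (fun s hs => by
      have := hm ⟨s, hs⟩
      rw [dist_comm, Real.dist_eq] at this
      exact this.le) t ht
    have e : C * (ε / (2 * C)) = ε / 2 := by field_simp
    rwa [e] at this
  rw [hYe m n ω ?_]
  · rw [hsum T le_rfl]
    have := hcl T ⟨hT, le_rfl⟩
    exact EReal.coe_le_coe_iff.2 (by linarith)
  · intro s hs
    rw [hsum s hs.2]
    have h1 := hcl s hs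
    have h2 := hadm s hs ω hω
    linarith

end PathwiseSuperhedging
end
end

section
/- Let [a,b] ⊆ ℝ and t ∈ [0,T]. For every Borel probability measure Q̄ on Ω̄ and every F̄_t-measurable function h̄ : Ω̄ → [a,b], there exists a sequence of continuous F̄_t-measurable functions h̄_k : Ω̄ → [a,b] which converges Q̄-almost surely to h̄. -/
open MeasureTheory Filter Set Topology
open scoped ENNReal Classical

noncomputable section

namespace PathwiseSuperhedging

/-- Stopping both coordinates at time `t`. -/
def stopPair (T : ℝ) (t : Set.Icc (0:ℝ) T) (p : PathPair T) : PathPair T :=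
  (stopPath T p.1 t, stopPath T p.2 t)

lemma continuous_stopPath (T : ℝ) (t : Set.Icc (0:ℝ) T) :
    Continuous (fun ω : Path T => stopPath T ω t) := by
  have hc : Continuous (fun s : Set.Icc (0:ℝ) T =>
      (⟨min t.1 s.1, le_min t.2.1 s.2.1, (min_le_left _ _).trans t.2.2⟩ : Set.Icc (0:ℝ) T)) :=
    (continuous_const.min continuous_subtype_val).subtype_mk _
  exact ContinuousMap.continuous_precomp (Y := Set.Icc (0:ℝ) T) ⟨_, hc⟩

lemma continuous_stopPair (T : ℝ) (t : Set.Icc (0:ℝ) T) : Continuous (stopPair T t) :=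
  ((continuous_stopPath T t).comp continuous_fst).prodMk
    ((continuous_stopPath T t).comp continuous_snd)

lemma measurable_of_eval (T : ℝ) (hne : Nonempty (Set.Icc (0:ℝ) T)) {Ω : Type*}
    (m : MeasurableSpace Ω) (F : Ω → PathPair T)
    (hF : ∀ s, Measurable fun x => ((F x).1 s, (F x).2 s)) : Measurable F := by
  let e : PathPair T → ℕ → ℝ × ℝ := fun p n =>
    (p.1 (TopologicalSpace.denseSeq _ n), p.2 (TopologicalSpace.denseSeq _ n))
  have hec : Continuous e := by
    refine continuous_pi fun n => ?_
    exact ((continuous_eval_const _).comp continuous_fst).prodMk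
      ((continuous_eval_const _).comp continuous_snd)
  have hinj : Function.Injective e := by
    intro p q h
    have hd := TopologicalSpace.denseRange_denseSeq (Set.Icc (0:ℝ) T)
    have h1 : ⇑p.1 = ⇑q.1 := hd.equalizer p.1.continuous q.1.continuous
      (funext fun n => congrArg Prod.fst (congrFun h n))
    have h2 : ⇑p.2 = ⇑q.2 := hd.equalizer p.2.continuous q.2.continuous
      (funext fun n => congrArg Prod.snd (congrFun h n))
    exact Prod.ext (DFunLike.coe_injective h1) (DFunLike.coe_injective h2)
  have hem : MeasurableEmbedding e := hec.measurableEmbedding hinj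
  rw [← hem.measurable_comp_iff]
  exact measurable_pi_lambda _ fun n => hF _

lemma FbarRaw_le (T : ℝ) (t : Set.Icc (0:ℝ) T) :
    FbarRaw T t ≤ MeasurableSpace.comap (stopPair T t) inferInstance := by
  refine iSup₂_le fun s hs => ?_
  have hev : Measurable (fun p : PathPair T => (p.1 s, p.2 s)) :=
    (((continuous_eval_const s).comp continuous_fst).prodMk
      ((continuous_eval_const s).comp continuous_snd)).measurable
  have heq : (fun p : PathPair T => (p.1 s, p.2 s)) =
      (fun p : PathPair T => (p.1 s, p.2 s)) ∘ stopPair T t := by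
    funext p
    have : (⟨min t.1 s.1, le_min t.2.1 s.2.1, (min_le_left _ _).trans t.2.2⟩
      : Set.Icc (0:ℝ) T) = s := Subtype.ext (min_eq_right hs)
    simp [stopPair, stopPath, this]
  rw [heq, ← MeasurableSpace.comap_comp]
  exact MeasurableSpace.comap_mono hev.comap_le

lemma measurable_stopPair (T : ℝ) (t : Set.Icc (0:ℝ) T) :
    Measurable[FbarRaw T t] (stopPair T t) := by
  refine measurable_of_eval T ⟨t⟩ (FbarRaw T t) _ fun s => ?_
  rw [measurable_iff_comap_le]
  exact le_iSup₂_of_le (f := fun (s : Set.Icc (0:ℝ) T) (_ : (s : ℝ) ≤ t) =>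
    MeasurableSpace.comap (fun p : PathPair T => (p.1 s, p.2 s)) inferInstance)
    ⟨min t.1 s.1, le_min t.2.1 s.2.1, (min_le_left _ _).trans t.2.2⟩ (min_le_left _ _) le_rfl

lemma approx_ae {X : Type*} [MetricSpace X] [MeasurableSpace X] [BorelSpace X]
    (μ : Measure X) [IsProbabilityMeasure μ] (g : X → ℝ) (hg : Integrable g μ) :
    ∃ gk : ℕ → X → ℝ, (∀ k, Continuous (gk k)) ∧
      ∀ᵐ x ∂μ, Tendsto (fun k => gk k x) atTop (nhds (g x)) := by
  have hg1 : MemLp g 1 μ := memLp_one_iff_integrable.2 hg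
  have H : ∀ n : ℕ, ∃ f : BoundedContinuousFunction X ℝ,
      eLpNorm (g - (f : X → ℝ)) 1 μ ≤ ((n : ℝ≥0∞) + 1)⁻¹ ∧ MemLp f 1 μ := fun n =>
    hg1.exists_boundedContinuous_eLpNorm_sub_le ENNReal.one_ne_top
      (by simp)
  choose f hf hfm using H
  have hlim : Tendsto (fun n => eLpNorm ((f n : X → ℝ) - g) 1 μ) atTop (nhds 0) := by
    refine tendsto_of_tendsto_of_tendsto_of_le_of_le tendsto_const_nhds
      ((tendsto_add_atTop_iff_nat 1).2 ENNReal.tendsto_inv_nat_nhds_zero)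
      (fun _ => zero_le) fun n => ?_
    rw [eLpNorm_sub_comm]
    simpa using hf n
  have hm := tendstoInMeasure_of_tendsto_eLpNorm one_ne_zero
    (fun n => (hfm n).1) hg1.1 hlim
  obtain ⟨ns, -, hns⟩ := hm.exists_seq_tendsto_ae
  exact ⟨fun k => f (ns k), fun k => (f (ns k)).continuous, hns⟩

/-- **Lemma 5.3 (approximation of `F̄_t`-measurable functions).** For every Borel
probability measure `Q̄` on `Ω̄` and every `F̄_t`-measurable `h̄ : Ω̄ → [a,b]` there are
continuous `F̄_t`-measurable functions `h̄_k : Ω̄ → [a,b]` converging `Q̄`-a.s. to `h̄`. -/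
theorem approx_measurable_at_time (T : ℝ) (a b : ℝ) (hab : a ≤ b) (t : ℝ) (ht : t ∈ Set.Icc (0:ℝ) T)
    (Q : Measure (PathPair T)) [IsProbabilityMeasure Q]
    (hbar : PathPair T → ℝ)
    (hmeas : Measurable[FbarRaw T t] hbar)
    (hrange : ∀ p, hbar p ∈ Set.Icc a b) :
    ∃ hk : ℕ → PathPair T → ℝ,
      (∀ k, Continuous (hk k)) ∧
      (∀ k, Measurable[FbarRaw T t] (hk k)) ∧
      (∀ k p, hk k p ∈ Set.Icc a b) ∧
      (∀ᵐ p ∂Q, Tendsto (fun k => hk k p) atTop (nhds (hbar p))) := by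
  have hclamp : ∀ x : ℝ, max a (min b x) ∈ Set.Icc a b := fun x =>
    ⟨le_max_left _ _, max_le hab (min_le_left _ _)⟩
  have hcc : Continuous fun x : ℝ => max a (min b x) := by fun_prop
  let t' : Set.Icc (0:ℝ) T := ⟨t, ht⟩
  have hπ : Measurable (stopPair T t') := (continuous_stopPair T t').measurable
  have hm2 : Measurable[MeasurableSpace.comap (stopPair T t') inferInstance] hbar :=
    hmeas.mono (FbarRaw_le T t') le_rfl
  obtain ⟨g, hg, hgeq⟩ := hm2.exists_eq_measurable_comp
  have hgm : Measurable (fun p => max a (min b (g p))) := hcc.measurable.comp hg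
  have : IsProbabilityMeasure (Q.map (stopPair T t')) :=
    Measure.isProbabilityMeasure_map hπ.aemeasurable
  have hint : Integrable (fun p => max a (min b (g p))) (Q.map (stopPair T t')) :=
    Integrable.of_mem_Icc a b hgm.aemeasurable (Eventually.of_forall fun p => hclamp _)
  obtain ⟨gk, hgc, hgt⟩ := approx_ae _ _ hint
  have hgt' := ae_of_ae_map hπ.aemeasurable hgt
  refine ⟨fun k p => max a (min b (gk k (stopPair T t' p))), fun k => ?_, fun k => ?_,
    fun k p => hclamp _, ?_⟩
  · exact hcc.comp ((hgc k).comp (continuous_stopPair T t'))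
  · exact (hcc.comp (hgc k)).measurable.comp (measurable_stopPair T t')
  · filter_upwards [hgt'] with p hp
    have h1 : g (stopPair T t' p) = hbar p := by rw [hgeq]; rfl
    have h2 : ∀ x ∈ Set.Icc a b, max a (min b x) = x := fun x hx => by
      rw [min_eq_right hx.2, max_eq_right hx.1]
    rw [h1, h2 _ (hrange p)] at hp
    have := (hcc.tendsto (hbar p)).comp hp
    rwa [h2 _ (hrange p)] at this


end PathwiseSuperhedging
end
end

section
/- Let Ω be any metric space and X : Ω → C[0,T] a continuous map, writing X_r(ω) := X(ω)(r). Fix 0 ≤ s < t ≤ T and m > 0, and define τ(ω) := inf{ r ≥ s : X_r(ω) > m or X_r(ω) ≤ −m } ∧ T. Then the function ω ↦ X_{τ(ω)∧t}(ω) is lower semicontinuous on Ω. -/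
open MeasureTheory Filter Set Topology
open scoped ENNReal Classical

noncomputable section

namespace PathwiseSuperhedging

lemma aux_lsc {W : Type*} [TopologicalSpace W] (T : ℝ) (Y : W → ℝ → ℝ)
    (hY : Continuous (fun p : W × ℝ => Y p.1 p.2))
    (s t : ℝ) (hst : s < t) (htT : t ≤ T) (m : ℝ) (hm : 0 < m)
    (τ : W → ℝ)
    (hτ : ∀ w, τ w = sInf ({r : ℝ | s ≤ r ∧ r ≤ T ∧ (m < Y w r ∨ Y w r ≤ -m)} ∪ {T})) :
    LowerSemicontinuous (fun w => Y w (min (τ w) t)) := by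
  have hsT : s < T := hst.trans_le htT
  have hbdd : ∀ w, BddBelow ({r : ℝ | s ≤ r ∧ r ≤ T ∧ (m < Y w r ∨ Y w r ≤ -m)} ∪ {T}) := by
    intro w
    refine ⟨s, ?_⟩
    rintro r (hr | hr)
    · exact hr.1
    · rw [Set.mem_singleton_iff] at hr
      rw [hr]; exact hsT.le
  have hYc : ∀ w, Continuous (Y w) := fun w =>
    hY.comp (Continuous.prodMk continuous_const continuous_id)
  have hYw : ∀ r, Continuous (fun w => Y w r) := fun r =>
    hY.comp (Continuous.prodMk continuous_id continuous_const)
  have F1 : ∀ w, s ≤ τ w := by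
    intro w
    rw [hτ]
    refine le_csInf ⟨T, Or.inr rfl⟩ ?_
    rintro r (hr | hr)
    · exact hr.1
    · rw [Set.mem_singleton_iff] at hr
      rw [hr]; exact hsT.le
  have F1' : ∀ w, τ w ≤ T := by
    intro w
    rw [hτ]
    exact csInf_le (hbdd w) (Or.inr rfl)
  have F4 : ∀ w r, s ≤ r → r ≤ T → (m < Y w r ∨ Y w r ≤ -m) → τ w ≤ r := by
    intro w r h1 h2 h3
    rw [hτ]
    exact csInf_le (hbdd w) (Or.inl ⟨h1, h2, h3⟩)
  have F2 : ∀ w r, s ≤ r → r < τ w → -m < Y w r ∧ Y w r ≤ m := by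
    intro w r h1 h2
    have : ¬ (m < Y w r ∨ Y w r ≤ -m) := fun h =>
      absurd (F4 w r h1 (h2.le.trans (F1' w)) h) (not_le.mpr h2)
    push Not at this
    exact ⟨this.2, this.1⟩
  have F3 : ∀ w b, τ w < b → b ≤ T → ∃ r, τ w ≤ r ∧ r < b ∧ (m < Y w r ∨ Y w r ≤ -m) := by
    intro w b hb hbT
    have hb' := hb
    rw [hτ] at hb'
    obtain ⟨r, hr, hrb⟩ := exists_lt_of_csInf_lt ⟨T, Or.inr rfl⟩ hb'
    rcases hr with hr | hr
    · exact ⟨r, F4 w r hr.1 hr.2.1 hr.2.2, hrb, hr.2.2⟩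
    · rw [Set.mem_singleton_iff] at hr
      linarith
  have D2 : ∀ w r, s < r → r ≤ τ w → -m ≤ Y w r ∧ Y w r ≤ m := by
    intro w r h1 h2
    have hcl : r ∈ closure (Set.Ico s r) := by
      rw [closure_Ico h1.ne]; exact ⟨h1.le, le_rfl⟩
    have hclosed : IsClosed {x | -m ≤ Y w x ∧ Y w x ≤ m} :=
      (isClosed_le continuous_const (hYc w)).inter (isClosed_le (hYc w) continuous_const)
    have hsub : Set.Ico s r ⊆ {x | -m ≤ Y w x ∧ Y w x ≤ m} := by
      intro x hx
      have := F2 w x hx.1 (hx.2.trans_le h2)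
      exact ⟨this.1.le, this.2⟩
    exact closure_minimal hsub hclosed hcl
  have near : ∀ (P : ℝ → Prop) a b, a < b → (∀ᶠ x in 𝓝 a, P x) →
      ∃ c, a < c ∧ c ≤ b ∧ ∀ x, a ≤ x → x < c → P x := by
    intro P a b hab h
    obtain ⟨ε, hε, h⟩ := Metric.eventually_nhds_iff.mp h
    refine ⟨min (a + ε) b, lt_min (by linarith) hab, min_le_right _ _, ?_⟩
    intro x hx hx2
    apply h
    have := hx2.trans_le (min_le_left _ _)
    rw [Real.dist_eq, abs_lt]
    constructor <;> linarith
  have D' : ∀ w, τ w < T → -m < Y w (τ w) → m ≤ Y w (τ w) := by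
    intro w h1 h2
    by_contra! h3
    obtain ⟨c, hc, hcT, h⟩ := near (fun x => -m < Y w x ∧ Y w x < m) _ T h1
      (((hYc w).continuousAt.eventually (lt_mem_nhds h2)).and
        ((hYc w).continuousAt.eventually (gt_mem_nhds h3)))
    obtain ⟨r, hr1, hr2, hr3⟩ := F3 w c hc hcT
    have := h r hr1 hr2
    rcases hr3 with h | h <;> linarith
  have unif : ∀ w b, (∀ r ∈ Set.Icc s b, -m < Y w r) →
      ∀ᶠ w' in 𝓝 w, ∀ r ∈ Set.Icc s b, -m < Y w' r := by
    intro w b h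
    apply isCompact_Icc.eventually_forall_of_forall_eventually
    intro r hr
    exact hY.continuousAt.eventually (lt_mem_nhds (h r hr))
  intro w c hc
  change c < Y w (min (τ w) t) at hc
  change ∀ᶠ w' in 𝓝 w, c < Y w' (min (τ w') t)
  rcases le_or_gt (Y w (min (τ w) t)) (-m) with h1 | h1
  · have hs : Y w (min (τ w) t) ≤ Y w s := by
      rcases (F1 w).eq_or_lt with h | h
      · rw [← h, min_eq_left hst.le]
      · exact h1.trans (F2 w s le_rfl h).1.le
    filter_upwards [(hYw s).continuousAt.eventually (lt_mem_nhds (hc.trans_le hs))] with w' hw'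
    rcases (F1 w').eq_or_lt with h | h
    · rw [← h, min_eq_left hst.le]; exact hw'
    · exact (hc.trans_le h1).trans_le (D2 w' _ (lt_min h hst) (min_le_left _ _)).1
  rcases lt_or_ge m (Y w (min (τ w) t)) with h2 | h2
  · have hs : τ w = s := by
      by_contra hne
      have h := lt_of_le_of_ne (F1 w) (Ne.symm hne)
      have := (D2 w _ (lt_min h hst) (min_le_left _ _)).2
      linarith
    rw [hs, min_eq_left hst.le] at hc h2
    filter_upwards [(hYw s).continuousAt.eventually (lt_mem_nhds hc),
      (hYw s).continuousAt.eventually (lt_mem_nhds h2)] with w' h3 h4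
    have : τ w' = s := le_antisymm (F4 w' s le_rfl hsT.le (Or.inl h4)) (F1 w')
    rw [this, min_eq_left hst.le]; exact h3
  rcases le_or_gt t (τ w) with h3 | h3
  · rw [min_eq_right h3] at hc h1 h2
    have hall : ∀ r ∈ Set.Icc s t, -m < Y w r := by
      intro r hr
      rcases hr.2.eq_or_lt with h | h
      · rw [h]; exact h1
      · exact (F2 w r hr.1 (h.trans_le h3)).1
    filter_upwards [unif w t hall, (hYw t).continuousAt.eventually (lt_mem_nhds hc)] with w' h4 h5
    rcases le_or_gt t (τ w') with h | h
    · rw [min_eq_right h]; exact h5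
    · rw [min_eq_left h.le]
      exact (hc.trans_le h2).trans_le
        (D' w' (h.trans_le htT) (h4 _ ⟨F1 w', h.le⟩))
  · rw [min_eq_left h3.le] at hc h1 h2
    obtain ⟨b, hb, hbt, h⟩ := near (fun x => -m < Y w x) _ t h3
      ((hYc w).continuousAt.eventually (lt_mem_nhds h1))
    obtain ⟨r, hr1, hr2, hr3⟩ := F3 w b hb (hbt.trans htT)
    have hr4 : m < Y w r := by
      rcases hr3 with h' | h'
      · exact h'
      · have := h r hr1 hr2
        linarith
    have hall : ∀ x ∈ Set.Icc s r, -m < Y w x := by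
      intro x hx
      rcases lt_or_ge x (τ w) with h' | h'
      · exact (F2 w x hx.1 h').1
      · exact h x h' (hx.2.trans_lt hr2)
    filter_upwards [unif w r hall, (hYw r).continuousAt.eventually (lt_mem_nhds hr4)] with w' h4 h5
    have hrt : r < t := hr2.trans_le hbt
    have h6 : τ w' ≤ r := F4 w' r ((F1 w).trans hr1) (hrt.le.trans htT) (Or.inl h5)
    rw [min_eq_left (h6.trans hrt.le)]
    exact (hc.trans_le h2).trans_le
      (D' w' ((h6.trans_lt hrt).trans_le htT) (h4 _ ⟨F1 w', h6⟩))

/-- **Lemma 5.4 (lower semicontinuity of the stopped evaluation).** Let `W` be a metric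
space and `X : W → C[0,T]` continuous. For `0 ≤ s < t ≤ T` and `m > 0`, let
`τ(w) = inf{ r ≥ s : X_r(w) > m or X_r(w) ≤ -m } ∧ T` (equal to `T` if no such `r`
exists). Then `w ↦ X_{τ(w) ∧ t}(w)` is lower semicontinuous. -/
theorem stopped_eval_lsc (T : ℝ) (hT : 0 ≤ T) {W : Type*} [MetricSpace W]
    (X : W → Path T) (hX : Continuous X)
    (s t : ℝ) (hs : 0 ≤ s) (hst : s < t) (htT : t ≤ T) (m : ℝ) (hm : 0 < m)
    (τ : W → ℝ)
    (hτ : ∀ w, τ w = sInf ({r : ℝ | s ≤ r ∧ r ≤ T ∧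
        (m < X w (clamp T hT r) ∨ X w (clamp T hT r) ≤ -m)} ∪ {T})) :
    LowerSemicontinuous (fun w => X w (clamp T hT (min (τ w) t))) := by
  refine aux_lsc T (fun w r => X w (clamp T hT r)) ?_ s t hst htT m hm τ hτ
  have h1 : Continuous (clamp T hT) := continuous_projIcc (h := hT)
  exact (hX.comp continuous_fst).eval (h1.comp continuous_snd)

end PathwiseSuperhedging
end
end
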